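/- arXiv:1712.07057 — 2 statements merged into one kernel-verified Lean document; each statement's English description precedes it below -/
import Mathlib

section
/- For any circular matrix A of order m×n and any b ∈ ℤ^m with b ≥ 0, the covering polyhedron Q*(A,b) equals the convex hull of the union over all β ∈ ℕ of the slices Q_β(A,b) := Q(A,b) ∩ {x ∈ ℝⁿ : 1ᵀx = β}. -/
namespace CircCover

attribute [local instance] Classical.propDecidable

/-- Membership in the circular interval `[a, a + k)ₙ` of `ZMod n`. -/
def inInterval {n : ℕ} (a : ZMod n) (k : ℕ) (j : ZMod n) : Prop :=
  ∃ s : ℕ, s < k ∧ j = a + (s : ZMod n)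

/-- The `{0,1}`-matrix whose `i`-th row is the incidence vector of `[ℓ i, ℓ i + k i)ₙ`. -/
noncomputable def circMatrix {m n : ℕ} (ℓ : Fin m → ZMod n) (k : Fin m → ℕ) :
    Matrix (Fin m) (ZMod n) ℝ :=
  fun i j => if inInterval (ℓ i) (k i) j then 1 else 0

/-- The condition `2 ≤ kᵢ ≤ n - 1` making `circMatrix ℓ k` a circular matrix. -/
def circBounds (n : ℕ) {m : ℕ} (k : Fin m → ℕ) : Prop :=
  ∀ i, 2 ≤ k i ∧ k i ≤ n - 1

/-- Arcs of the digraph `D(A)` associated with a circular matrix. -/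
inductive Arc (m n : ℕ) : Type
  | fwdRow (i : Fin m)
  | fwdShort (j : ZMod n)
  | revRow (i : Fin m)
  | revShort (j : ZMod n)
  deriving DecidableEq

namespace Arc

variable {m n : ℕ} (ℓ : Fin m → ZMod n) (k : Fin m → ℕ)

/-- The tail of an arc of `D(A)`. -/
def tail : Arc m n → ZMod n
  | fwdRow i => ℓ i - 1
  | fwdShort j => j - 1
  | revRow i => ℓ i + (k i : ZMod n) - 1
  | revShort j => j

/-- The head of an arc of `D(A)`. -/
def head : Arc m n → ZMod n
  | fwdRow i => ℓ i + (k i : ZMod n) - 1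
  | fwdShort j => j
  | revRow i => ℓ i - 1
  | revShort j => j - 1

/-- The oriented length of an arc of `D(A)`. -/
def len (k : Fin m → ℕ) : Arc m n → ℤ
  | fwdRow i => (k i : ℤ)
  | fwdShort _ => 1
  | revRow i => -(k i : ℤ)
  | revShort _ => -1

/-- Forward arcs. -/
def IsForward : Arc m n → Prop
  | fwdRow _ => True
  | fwdShort _ => True
  | _ => False

/-- Forward row arcs. -/
def IsFwdRow : Arc m n → Prop
  | fwdRow _ => True
  | _ => False

/-- Reverse row arcs. -/
def IsRevRow : Arc m n → Prop
  | revRow _ => True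
  | _ => False

/-- Forward short arcs. -/
def IsFwdShort : Arc m n → Prop
  | fwdShort _ => True
  | _ => False

/-- The arc jumps over node `j`. -/
def Jumps : Arc m n → ZMod n → Prop
  | fwdRow i, j => inInterval (ℓ i) (k i) j
  | fwdShort j', j => j' = j
  | revRow i, j => inInterval (ℓ i) (k i) j
  | revShort j', j => j' = j

end Arc

variable {m n : ℕ}

/-- A (not necessarily simple) closed directed path in `D(A)`, given as its list of arcs. -/
def IsClosedWalk (ℓ : Fin m → ZMod n) (k : Fin m → ℕ) (γ : List (Arc m n)) : Prop :=
  ∃ h : γ ≠ [],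
    List.Chain' (fun a b => Arc.head ℓ k a = Arc.tail ℓ k b) γ ∧
      Arc.head ℓ k (γ.getLast h) = Arc.tail ℓ k (γ.head h)

/-- A simple directed circuit in `D(A)`: a closed directed path visiting pairwise
distinct nodes. -/
def IsCircuit (ℓ : Fin m → ZMod n) (k : Fin m → ℕ) (γ : List (Arc m n)) : Prop :=
  IsClosedWalk ℓ k γ ∧ (γ.map (Arc.tail ℓ k)).Nodup

/-- The sum of the oriented lengths of the arcs of `γ`; it equals `p(γ) * n` where `p(γ)`
is the winding number. -/
def windingSum (k : Fin m → ℕ) (γ : List (Arc m n)) : ℤ :=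
  (γ.map (Arc.len k)).sum

/-- `p⁺(γ, j)`: the number of forward arcs of `γ` jumping over `j`. -/
noncomputable def pPlus (ℓ : Fin m → ZMod n) (k : Fin m → ℕ) (γ : List (Arc m n))
    (j : ZMod n) : ℕ :=
  γ.countP fun a => decide (Arc.IsForward a ∧ Arc.Jumps ℓ k a j)

/-- `p⁻(γ, j)`: the number of reverse arcs of `γ` jumping over `j`. -/
noncomputable def pMinus (ℓ : Fin m → ZMod n) (k : Fin m → ℕ) (γ : List (Arc m n))
    (j : ZMod n) : ℕ :=
  γ.countP fun a => decide (¬ Arc.IsForward a ∧ Arc.Jumps ℓ k a j)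

/-- The number of (forward) row arcs of `γ` jumping over `j`. -/
noncomputable def rowJumpCount (ℓ : Fin m → ZMod n) (k : Fin m → ℕ) (γ : List (Arc m n))
    (j : ZMod n) : ℕ :=
  γ.countP fun a => decide (Arc.IsFwdRow a ∧ Arc.Jumps ℓ k a j)

/-- The number of forward row arcs of `γ`. -/
def numRowArcs (γ : List (Arc m n)) : ℕ :=
  γ.countP fun a => match a with | Arc.fwdRow _ => true | _ => false

/-- `t(γ, b) = ∑_{aᵢ ∈ γ} bᵢ - ∑_{āᵢ ∈ γ} bᵢ`. -/
def tVal (b : Fin m → ℤ) (γ : List (Arc m n)) : ℤ :=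
  (γ.map fun a => match a with
    | Arc.fwdRow i => b i
    | Arc.revRow i => -(b i)
    | _ => 0).sum

/-- `t⁻(γ, b) = ∑_{āᵢ ∈ γ} bᵢ`. -/
def tMinusVal (b : Fin m → ℤ) (γ : List (Arc m n)) : ℤ :=
  (γ.map fun a => match a with
    | Arc.revRow i => b i
    | _ => 0).sum

/-- `β(γ, b) = ⌊t(γ, b) / p⌋`. -/
def betaVal (b : Fin m → ℤ) (γ : List (Arc m n)) (p : ℤ) : ℤ :=
  Int.fdiv (tVal b γ) p

/-- `r(γ, b) = t(γ, b) - β(γ, b) * p`. -/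
def rVal (b : Fin m → ℤ) (γ : List (Arc m n)) (p : ℤ) : ℤ :=
  tVal b γ - betaVal b γ p * p

/-- The `γ`-inequality `∑ⱼ (p⁻(γ,j) + r) xⱼ ≥ r (β + 1) + ∑_{āᵢ ∈ γ} bᵢ`. -/
def GammaIneqHolds [NeZero n] (ℓ : Fin m → ZMod n) (k : Fin m → ℕ) (b : Fin m → ℤ)
    (γ : List (Arc m n)) (p : ℤ) (x : ZMod n → ℝ) : Prop :=
  ∑ j : ZMod n, ((pMinus ℓ k γ j : ℝ) + (rVal b γ p : ℝ)) * x j ≥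
    (rVal b γ p : ℝ) * ((betaVal b γ p : ℝ) + 1) + (tMinusVal b γ : ℝ)

/-- The fractional covering polyhedron `Q(A, b) = {x ≥ 0 : A x ≥ b}`. -/
def Qpoly [NeZero n] (A : Matrix (Fin m) (ZMod n) ℝ) (b : Fin m → ℝ) :
    Set (ZMod n → ℝ) :=
  {x | (∀ j, 0 ≤ x j) ∧ ∀ i, b i ≤ ∑ j : ZMod n, A i j * x j}

/-- A point of `ℝⁿ` all whose coordinates are integers. -/
def IsIntegerPoint {n : ℕ} (x : ZMod n → ℝ) : Prop :=
  ∀ j, ∃ z : ℤ, x j = (z : ℝ)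

/-- The covering polyhedron `Q*(A, b) = conv{x ∈ ℤⁿ : x ≥ 0, A x ≥ b}`. -/
noncomputable def Qstar [NeZero n] (A : Matrix (Fin m) (ZMod n) ℝ) (b : Fin m → ℝ) :
    Set (ZMod n → ℝ) :=
  convexHull ℝ {x | IsIntegerPoint x ∧ x ∈ Qpoly A b}

/-- The slack of row `i` of `A` at the point `x`. -/
noncomputable def rowSlack [NeZero n] (ℓ : Fin m → ZMod n) (k : Fin m → ℕ)
    (b : Fin m → ℤ) (x : ZMod n → ℝ) (i : Fin m) : ℝ :=
  (∑ j : ZMod n, circMatrix ℓ k i j * x j) - (b i : ℝ)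

/-- `μ = ⌈1ᵀ x⌉ - 1ᵀ x`. -/
noncomputable def muVal [NeZero n] (x : ZMod n → ℝ) : ℝ :=
  (⌈∑ j : ZMod n, x j⌉ : ℝ) - ∑ j : ZMod n, x j

/-- Entry `i` of the last column `v` of `Ã` (the column indexed by `n ≡ 0`). -/
noncomputable def vRow (ℓ : Fin m → ZMod n) (k : Fin m → ℕ) (i : Fin m) : ℝ :=
  circMatrix ℓ k i 0

/-- Entry `m + j` of the last column `v` of `Ã`. -/
noncomputable def vShort (j : ZMod n) : ℝ :=
  if j = 0 then 1 else 0

/-- The cost of an arc in the weighted digraph `D(A, x)`: forward arcs carry the cost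
`c⁺ = μ (s* - (1 - μ) v)` and reverse arcs the cost `c⁻ = (1 - μ)(s* + μ v)`. -/
noncomputable def arcCost [NeZero n] (ℓ : Fin m → ZMod n) (k : Fin m → ℕ)
    (b : Fin m → ℤ) (x : ZMod n → ℝ) : Arc m n → ℝ
  | Arc.fwdRow i => muVal x * (rowSlack ℓ k b x i - (1 - muVal x) * vRow ℓ k i)
  | Arc.fwdShort j => muVal x * (x j - (1 - muVal x) * vShort j)
  | Arc.revRow i => (1 - muVal x) * (rowSlack ℓ k b x i + muVal x * vRow ℓ k i)
  | Arc.revShort j => (1 - muVal x) * (x j + muVal x * vShort j)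

/-- The cost `c(γ, x)` of a walk `γ` in `D(A, x)`. -/
noncomputable def walkCost [NeZero n] (ℓ : Fin m → ZMod n) (k : Fin m → ℕ)
    (b : Fin m → ℤ) (x : ZMod n → ℝ) (γ : List (Arc m n)) : ℝ :=
  (γ.map (arcCost ℓ k b x)).sum

/-- Row `i` dominates row `i'` of `A`. -/
def Dominates (A : Matrix (Fin m) (ZMod n) ℝ) (i i' : Fin m) : Prop :=
  i ≠ i' ∧ ∀ j, A i' j ≤ A i j

/-- `A` has no dominating rows. -/
def NoDominatingRows (A : Matrix (Fin m) (ZMod n) ℝ) : Prop :=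
  ∀ i i', ¬ Dominates A i i'

/-- The affine dimension of a subset of `ℝⁿ` (`-1` for the empty set). -/
noncomputable def adim [NeZero n] (S : Set (ZMod n → ℝ)) : ℤ :=
  if S = ∅ then -1 else (Module.finrank ℝ (affineSpan ℝ S).direction : ℤ)

/-- The valid inequality `aᵀ x ≥ α₀` defines a facet of `P`:
the face it defines has affine dimension `dim P - 1`. -/
def IsFacetIneq [NeZero n] (P : Set (ZMod n → ℝ)) (a : ZMod n → ℝ) (α₀ : ℝ) : Prop :=
  (∀ x ∈ P, α₀ ≤ ∑ j : ZMod n, a j * x j) ∧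
    adim {x ∈ P | ∑ j : ZMod n, a j * x j = α₀} = adim P - 1

/-- `j` is a node of the walk `γ`. -/
def IsNodeOf (ℓ : Fin m → ZMod n) (k : Fin m → ℕ) (γ : List (Arc m n)) (j : ZMod n) : Prop :=
  ∃ a ∈ γ, Arc.tail ℓ k a = j

/-- `j` is an essential bullet of `γ`: a node of `γ` which is neither a circle
(head of a forward short arc of `γ`) nor a cross (tail of a reverse short arc of `γ`). -/
def IsEssentialBullet (ℓ : Fin m → ZMod n) (k : Fin m → ℕ) (γ : List (Arc m n))
    (j : ZMod n) : Prop :=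
  IsNodeOf ℓ k γ j ∧ Arc.fwdShort j ∉ γ ∧ Arc.revShort j ∉ γ

/-- The number of essential bullets of `γ`. -/
noncomputable def numEssentialBullets [NeZero n] (ℓ : Fin m → ZMod n) (k : Fin m → ℕ)
    (γ : List (Arc m n)) : ℕ :=
  (Finset.univ.filter fun j : ZMod n => IsEssentialBullet ℓ k γ j).card

/-- `∑_{i ∈ F} a_{ij}`, the number of rows of `F` whose interval contains `j`. -/
noncomputable def rowCount (ℓ : Fin m → ZMod n) (k : Fin m → ℕ) (F : Finset (Fin m))
    (j : ZMod n) : ℕ :=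
  (F.filter fun i => inInterval (ℓ i) (k i) j).card

/-- The row family inequality induced by `F` (with `p* = max_j ∑_{i ∈ F} a_{ij} - 1`). -/
def RowFamilyIneqHolds [NeZero n] (ℓ : Fin m → ZMod n) (k : Fin m → ℕ)
    (F : Finset (Fin m)) (x : ZMod n → ℝ) : Prop :=
  let s := F.card
  let pstar := (Finset.univ.sup fun j : ZMod n => rowCount ℓ k F j) - 1
  let rstar := s - pstar * (s / pstar)
  ((rstar : ℝ) + 1) * ∑ j ∈ Finset.univ.filter (fun j : ZMod n => rowCount ℓ k F j = pstar + 1), x j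
    + (rstar : ℝ) * ∑ j ∈ Finset.univ.filter (fun j : ZMod n => rowCount ℓ k F j ≤ pstar), x j
    ≥ (rstar : ℝ) * (((s + pstar - 1) / pstar : ℕ) : ℝ)


/-- A sum along `k ≤ n` consecutive elements of `ZMod n` is the sum over the circular interval. -/
lemma sum_range_eq_sum_inInterval {n : ℕ} [NeZero n] (f : ZMod n → ℝ) (a : ZMod n) {k : ℕ}
    (hk : k ≤ n) :
    ∑ s ∈ Finset.range k, f (a + (s : ZMod n)) =
      ∑ j : ZMod n, (if inInterval a k j then 1 else 0) * f j := by
  have hinj : Set.InjOn (fun s : ℕ => a + (s : ZMod n)) (Finset.range k) := by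
    intro s hs t ht hst
    have h := congrArg ZMod.val (add_left_cancel hst)
    simp only [Finset.coe_range, Set.mem_Iio] at hs ht
    rwa [ZMod.val_natCast_of_lt (by omega), ZMod.val_natCast_of_lt (by omega)] at h
  rw [← Finset.sum_image (f := f) hinj]
  simp only [ite_mul, one_mul, zero_mul]
  rw [← Finset.sum_filter]
  refine Finset.sum_congr ?_ fun _ _ => rfl
  ext j
  rw [Finset.mem_filter]
  simp [inInterval, eq_comm]

/-- The prefix sum `x₀ + ⋯ + x_{t-1}` of the `n`-periodic extension of `x`. -/
noncomputable def prefixSum {n : ℕ} (x : ZMod n → ℝ) (t : ℕ) : ℝ :=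
  ∑ s ∈ Finset.range t, x (s : ZMod n)

lemma prefixSum_succ {n : ℕ} (x : ZMod n → ℝ) (t : ℕ) :
    prefixSum x (t + 1) = prefixSum x t + x (t : ZMod n) :=
  Finset.sum_range_succ _ _

lemma prefixSum_add {n : ℕ} (x : ZMod n → ℝ) (t k : ℕ) :
    prefixSum x (t + k) =
      prefixSum x t + ∑ s ∈ Finset.range k, x ((t : ZMod n) + (s : ZMod n)) := by
  simp [prefixSum, Finset.sum_range_add]

lemma prefixSum_add_period {n : ℕ} [NeZero n] (x : ZMod n → ℝ) (t : ℕ) :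
    prefixSum x (t + n) = prefixSum x t + ∑ j : ZMod n, x j := by
  rw [prefixSum_add, sum_range_eq_sum_inInterval x _ le_rfl]
  congr 1
  refine Finset.sum_congr rfl fun j _ => ?_
  rw [if_pos ⟨(j - t).val, ZMod.val_lt _, by simp⟩, one_mul]

lemma prefixSum_add_mul_period {n : ℕ} [NeZero n] (x : ZMod n → ℝ) (t q : ℕ) :
    prefixSum x (t + n * q) = prefixSum x t + q * ∑ j : ZMod n, x j := by
  induction q with
  | zero => simp
  | succ q ih =>
    rw [Nat.mul_succ, ← add_assoc, prefixSum_add_period, ih]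
    push_cast
    ring

/-- The rounding of `x` obtained by rounding down the prefix sums shifted by `θ`. -/
noncomputable def prefixRound {n : ℕ} (x : ZMod n → ℝ) (θ : ℝ) (j : ZMod n) : ℝ :=
  (⌊prefixSum x (j.val + 1) + θ⌋ : ℝ) - ⌊prefixSum x j.val + θ⌋

lemma prefixSum_val_succ {n : ℕ} [NeZero n] (x : ZMod n → ℝ) (j : ZMod n) :
    prefixSum x (j.val + 1) = prefixSum x j.val + x j := by
  rw [prefixSum_succ, ZMod.natCast_zmod_val]

lemma prefixRound_natCast {n : ℕ} [NeZero n] {x : ZMod n → ℝ} {β : ℕ}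
    (hβ : ∑ j : ZMod n, x j = β) (θ : ℝ) (t : ℕ) :
    prefixRound x θ (t : ZMod n) =
      (⌊prefixSum x (t + 1) + θ⌋ : ℝ) - ⌊prefixSum x t + θ⌋ := by
  have hper : ∀ r q : ℕ,
      ⌊prefixSum x (r + n * q) + θ⌋ = ⌊prefixSum x r + θ⌋ + ((q * β : ℕ) : ℤ) := by
    intro r q
    rw [prefixSum_add_mul_period, hβ, ← Int.floor_add_natCast]
    congr 1
    push_cast
    ring
  have h₀ := hper (t % n) (t / n)
  have h₁ := hper (t % n + 1) (t / n)
  rw [Nat.mod_add_div] at h₀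
  rw [add_right_comm, Nat.mod_add_div] at h₁
  rw [prefixRound, ZMod.val_natCast, h₀, h₁]
  push_cast
  ring

lemma sum_range_prefixRound {n : ℕ} [NeZero n] {x : ZMod n → ℝ} {β : ℕ}
    (hβ : ∑ j : ZMod n, x j = β) (θ : ℝ) (t k : ℕ) :
    ∑ s ∈ Finset.range k, prefixRound x θ ((t : ZMod n) + (s : ZMod n)) =
      (⌊prefixSum x (t + k) + θ⌋ : ℝ) - ⌊prefixSum x t + θ⌋ := by
  refine Eq.trans ?_ (Finset.sum_range_sub (fun s => (⌊prefixSum x (t + s) + θ⌋ : ℝ)) k)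
  refine Finset.sum_congr rfl fun s _ => ?_
  rw [← Nat.cast_add, prefixRound_natCast hβ, add_assoc t s 1]

/-- Rounding down two shifted reals preserves an integral lower bound on their difference. -/
lemma le_floor_sub_floor {u v : ℝ} {c : ℤ} (h : (c : ℝ) ≤ v - u) :
    (c : ℝ) ≤ (⌊v⌋ : ℝ) - ⌊u⌋ := by
  have : ⌊u⌋ + c ≤ ⌊v⌋ := by
    rw [← Int.floor_add_intCast]
    exact Int.floor_mono (by linarith)
  have : (⌊u⌋ : ℝ) + c ≤ ⌊v⌋ := by exact_mod_cast this
  linarith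

/-- Averaging `⌊y + θ⌋` over `θ ∈ (0, 1]` returns `y`. -/
lemma integral_floor_add (y : ℝ) : ∫ θ in (0 : ℝ)..1, (⌊y + θ⌋ : ℝ) = y := by
  have hfi : ∀ a b : ℝ,
      IntervalIntegrable (fun u : ℝ => (⌊u⌋ : ℝ)) MeasureTheory.volume a b := by
    intro a b
    exact (Monotone.monotoneOn (fun u v h => by
      exact_mod_cast Int.floor_mono h) _).intervalIntegrable
  have hunit : ∫ u in (0 : ℝ)..1, Int.fract u = 1 / 2 := by
    have h : ∫ u in (0 : ℝ)..1, Int.fract u = ∫ u in (0 : ℝ)..1, u := by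
      refine intervalIntegral.integral_congr_ae ?_
      have hne : ∀ᵐ u : ℝ, u ≠ 1 := by
        simp [MeasureTheory.ae_iff]
      filter_upwards [hne] with u hu hmem
      rw [Set.uIoc_of_le zero_le_one] at hmem
      exact Int.fract_eq_self.2 ⟨hmem.1.le, lt_of_le_of_ne hmem.2 hu⟩
    rw [h, integral_id]
    norm_num
  have hper : Function.Periodic (Int.fract : ℝ → ℝ) 1 := fun u => Int.fract_add_one u
  have hshift := hper.intervalIntegral_add_eq y 0
  rw [zero_add, hunit] at hshift
  have hsub : ∫ u in y..y + 1, Int.fract u =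
      (∫ u in y..y + 1, u) - ∫ u in y..y + 1, (⌊u⌋ : ℝ) := by
    rw [← intervalIntegral.integral_sub intervalIntegral.intervalIntegrable_id (hfi _ _)]
    rfl
  rw [intervalIntegral.integral_comp_add_left (fun u : ℝ => (⌊u⌋ : ℝ)) y, add_zero]
  rw [hshift, integral_id] at hsub
  linarith

lemma intervalIntegrable_floor_add (y : ℝ) :
    IntervalIntegrable (fun θ : ℝ => (⌊y + θ⌋ : ℝ)) MeasureTheory.volume 0 1 :=
  (Monotone.monotoneOn (fun u v h => by
    exact_mod_cast Int.floor_mono (by linarith : y + u ≤ y + v)) _).intervalIntegrable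

lemma intervalIntegrable_prefixRound {n : ℕ} (x : ZMod n → ℝ) (j : ZMod n) :
    IntervalIntegrable (fun θ => prefixRound x θ j) MeasureTheory.volume 0 1 :=
  (intervalIntegrable_floor_add _).sub (intervalIntegrable_floor_add _)

lemma integral_prefixRound {n : ℕ} [NeZero n] (x : ZMod n → ℝ) (j : ZMod n) :
    ∫ θ in (0 : ℝ)..1, prefixRound x θ j = x j := by
  simp only [prefixRound]
  rw [intervalIntegral.integral_sub (intervalIntegrable_floor_add _)
    (intervalIntegrable_floor_add _), integral_floor_add, integral_floor_add,
    prefixSum_val_succ]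
  ring

/-- Rounding the prefix sums keeps a point of an integral slice inside `Q(A, b)`. -/
lemma prefixRound_mem_Qpoly {m n : ℕ} [NeZero n] {ℓ : Fin m → ZMod n} {k : Fin m → ℕ}
    (hA : circBounds n k) {b : Fin m → ℤ} {x : ZMod n → ℝ}
    (hx : x ∈ Qpoly (circMatrix ℓ k) (fun i => (b i : ℝ))) {β : ℕ}
    (hβ : ∑ j : ZMod n, x j = β) (θ : ℝ) :
    prefixRound x θ ∈ Qpoly (circMatrix ℓ k) (fun i => (b i : ℝ)) := by
  refine ⟨fun j => ?_, fun i => ?_⟩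
  · have h := le_floor_sub_floor (u := prefixSum x j.val + θ)
      (v := prefixSum x (j.val + 1) + θ) (c := 0)
      (by rw [prefixSum_val_succ]; push_cast; linarith [hx.1 j])
    simpa [prefixRound] using h
  · have hk : k i ≤ n := (hA i).2.trans (Nat.sub_le _ _)
    have hrow := hx.2 i
    simp only [circMatrix] at hrow ⊢
    rw [← sum_range_eq_sum_inInterval _ _ hk] at hrow ⊢
    rw [← ZMod.natCast_zmod_val (ℓ i)] at hrow ⊢
    rw [sum_range_prefixRound hβ]
    refine le_floor_sub_floor ?_
    rw [prefixSum_add]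
    linarith

lemma isIntegerPoint_prefixRound {n : ℕ} (x : ZMod n → ℝ) (θ : ℝ) :
    IsIntegerPoint (prefixRound x θ) := fun j =>
  ⟨⌊prefixSum x (j.val + 1) + θ⌋ - ⌊prefixSum x j.val + θ⌋, by simp [prefixRound]⟩

lemma prefixRound_le {n : ℕ} [NeZero n] {x : ZMod n → ℝ} (hx : ∀ j, 0 ≤ x j) {β : ℕ}
    (hβ : ∑ j : ZMod n, x j = β) (θ : ℝ) (j : ZMod n) : prefixRound x θ j ≤ β := by
  have hle : x j ≤ β := hβ ▸ Finset.single_le_sum (fun i _ => hx i) (Finset.mem_univ j)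
  have h := le_floor_sub_floor (u := prefixSum x (j.val + 1) + θ)
    (v := prefixSum x j.val + θ) (c := -(β : ℤ))
    (by rw [prefixSum_val_succ]; push_cast; linarith)
  push_cast at h
  rw [prefixRound]
  linarith

/-- There are finitely many integer points in a cube. -/
lemma finite_isIntegerPoint_cube {n : ℕ} [NeZero n] (β : ℕ) :
    {x : ZMod n → ℝ | IsIntegerPoint x ∧ ∀ j, 0 ≤ x j ∧ x j ≤ β}.Finite := by
  refine (Set.Finite.pi' fun _ : ZMod n =>
    (Set.finite_Icc (0 : ℤ) β).image (fun z : ℤ => (z : ℝ))).subset ?_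
  rintro x ⟨hint, hx⟩ j
  obtain ⟨z, hz⟩ := hint j
  have h := hx j
  rw [hz] at h
  exact ⟨z, ⟨by exact_mod_cast h.1, by exact_mod_cast h.2⟩, hz.symm⟩

/-- The integral slices of `Q(A, b)` are contained in `Q*(A, b)`. -/
lemma mem_Qstar_of_sum_eq_natCast {m n : ℕ} [NeZero n] {ℓ : Fin m → ZMod n} {k : Fin m → ℕ}
    (hA : circBounds n k) {b : Fin m → ℤ} {x : ZMod n → ℝ}
    (hx : x ∈ Qpoly (circMatrix ℓ k) (fun i => (b i : ℝ))) {β : ℕ}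
    (hβ : ∑ j : ZMod n, x j = β) :
    x ∈ Qstar (circMatrix ℓ k) (fun i => (b i : ℝ)) := by
  let S : Set (ZMod n → ℝ) := Set.range (prefixRound x)
  have hfin : S.Finite := by
    refine (finite_isIntegerPoint_cube (n := n) β).subset ?_
    rintro _ ⟨θ, rfl⟩
    exact ⟨isIntegerPoint_prefixRound x θ, fun j =>
      ⟨(prefixRound_mem_Qpoly hA hx hβ θ).1 j, prefixRound_le hx.1 hβ θ j⟩⟩
  have hS : S ⊆ {y | IsIntegerPoint y ∧
      y ∈ Qpoly (circMatrix ℓ k) (fun i => (b i : ℝ))} := by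
    rintro _ ⟨θ, rfl⟩
    exact ⟨isIntegerPoint_prefixRound x θ, prefixRound_mem_Qpoly hA hx hβ θ⟩
  refine convexHull_mono hS ?_
  let μ : MeasureTheory.Measure ℝ := MeasureTheory.volume.restrict (Set.Ioc 0 1)
  have : MeasureTheory.IsProbabilityMeasure μ := ⟨by simp [μ]⟩
  have hcoord : ∀ j, MeasureTheory.Integrable (fun θ => prefixRound x θ j) μ := fun j =>
    (intervalIntegrable_iff_integrableOn_Ioc_of_le zero_le_one).1
      (intervalIntegrable_prefixRound x j)
  have hmem := (convex_convexHull ℝ S).integral_mem (hfin.isClosed_convexHull ℝ)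
    (μ := μ) (f := prefixRound x)
    (Filter.Eventually.of_forall fun θ => subset_convexHull ℝ S ⟨θ, rfl⟩)
    (MeasureTheory.Integrable.of_eval hcoord)
  convert hmem using 1
  ext j
  rw [MeasureTheory.eval_integral hcoord, ← integral_prefixRound x j,
    intervalIntegral.integral_of_le zero_le_one]

/-- For any circular matrix `A` and any `b ∈ ℤ^m` with `b ≥ 0`,
`Q*(A, b)` equals the convex hull of the union over `β ∈ ℕ` of the slices
`Q_β(A, b) = Q(A, b) ∩ {x : 1ᵀ x = β}`. -/
theorem Qstar_eq_convexHull_iUnion_slices {m n : ℕ} [NeZero n] (ℓ : Fin m → ZMod n)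
    (k : Fin m → ℕ) (hA : circBounds n k) (b : Fin m → ℤ) (hb : ∀ i, 0 ≤ b i) :
    Qstar (circMatrix ℓ k) (fun i => (b i : ℝ)) =
      convexHull ℝ (⋃ β : ℕ,
        Qpoly (circMatrix ℓ k) (fun i => (b i : ℝ)) ∩
          {x | ∑ j : ZMod n, x j = (β : ℝ)}) := by
  apply Set.Subset.antisymm
  · refine convexHull_mono ?_
    rintro x ⟨hint, hx⟩
    choose z hz using hint
    have hnonneg : 0 ≤ ∑ j, z j := Finset.sum_nonneg fun j _ => by
      have h := hx.1 j
      rw [hz j] at h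
      exact_mod_cast h
    refine Set.mem_iUnion.2 ⟨(∑ j, z j).toNat, hx, ?_⟩
    have hcast : (((∑ j, z j).toNat : ℤ) : ℝ) = ((∑ j, z j : ℤ) : ℝ) := by
      rw [Int.toNat_of_nonneg hnonneg]
    simp only [Set.mem_ofPred_eq, hz]
    rw [← Int.cast_natCast, hcast, Int.cast_sum]
  · refine convexHull_min ?_ (convex_convexHull ℝ _)
    intro x hx
    obtain ⟨β, hQ, hβ⟩ := Set.mem_iUnion.1 hx
    exact mem_Qstar_of_sum_eq_natCast hA hQ hβ

end CircCover
end

section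
/- Let A be a circular matrix of order m×n, b ∈ ℤ^m with b ≥ 0, x* ∈ Q(A,b) \ Q*(A,b), and Γ a simple directed circuit of negative cost in D(A,x*). Then x* violates the Γ-inequality, i.e., Σ_{j ∈ ZMod n} (p⁻(Γ,j) + r(Γ,b)) x*_j < r(Γ,b)(β(Γ,b)+1) + Σ_{i : ā_i ∈ E(Γ)} b_i. -/
namespace CircCover

attribute [local instance] Classical.propDecidable

variable {m n : ℕ}

/-- The indicator that the arc `a` jumps over `j`. -/
noncomputable def jumpInd (ℓ : Fin m → ZMod n) (k : Fin m → ℕ) (a : Arc m n) (j : ZMod n) : ℝ :=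
  if Arc.Jumps ℓ k a j then 1 else 0

theorem jumpInd_fwdRow (ℓ : Fin m → ZMod n) (k : Fin m → ℕ) (i : Fin m) (j : ZMod n) :
    jumpInd ℓ k (Arc.fwdRow i) j = circMatrix ℓ k i j :=
  rfl

theorem jumpInd_revRow (ℓ : Fin m → ZMod n) (k : Fin m → ℕ) (i : Fin m) (j : ZMod n) :
    jumpInd ℓ k (Arc.revRow i) j = circMatrix ℓ k i j :=
  rfl

theorem jumpInd_fwdShort (ℓ : Fin m → ZMod n) (k : Fin m → ℕ) (i j : ZMod n) :
    jumpInd ℓ k (Arc.fwdShort i) j = if i = j then 1 else 0 := by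
  unfold jumpInd
  congr

theorem jumpInd_revShort (ℓ : Fin m → ZMod n) (k : Fin m → ℕ) (i j : ZMod n) :
    jumpInd ℓ k (Arc.revShort i) j = if i = j then 1 else 0 := by
  unfold jumpInd
  congr

/-- The indicator of the reverse arcs. -/
def revInd : Arc m n → ℝ
  | Arc.fwdRow _ => 0
  | Arc.fwdShort _ => 0
  | Arc.revRow _ => 1
  | Arc.revShort _ => 1

/-- `p⁺(γ, j) - p⁻(γ, j)`, the net number of arcs of `γ` jumping over `j`. -/
noncomputable def netJumps (ℓ : Fin m → ZMod n) (k : Fin m → ℕ) (γ : List (Arc m n))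
    (j : ZMod n) : ℝ :=
  (pPlus ℓ k γ j : ℝ) - (pMinus ℓ k γ j : ℝ)

/-- `∑ⱼ p⁻(γ, j) xⱼ - t⁻(γ, b)`, the total slack of the reverse arcs of `γ`. -/
noncomputable def revSlack [NeZero n] (ℓ : Fin m → ZMod n) (k : Fin m → ℕ) (b : Fin m → ℤ)
    (x : ZMod n → ℝ) (γ : List (Arc m n)) : ℝ :=
  ∑ j : ZMod n, (pMinus ℓ k γ j : ℝ) * x j - (tMinusVal b γ : ℝ)

theorem pMinus_cons (ℓ : Fin m → ZMod n) (k : Fin m → ℕ) (a : Arc m n) (γ : List (Arc m n))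
    (j : ZMod n) :
    (pMinus ℓ k (a :: γ) j : ℝ) =
      revInd a * jumpInd ℓ k a j + pMinus ℓ k γ j := by
  unfold pMinus jumpInd
  rw [List.countP_cons]
  by_cases h : Arc.Jumps ℓ k a j <;> cases a <;>
    simp [h, Arc.IsForward, revInd, add_comm]

theorem netJumps_cons (ℓ : Fin m → ZMod n) (k : Fin m → ℕ) (a : Arc m n) (γ : List (Arc m n))
    (j : ZMod n) :
    netJumps ℓ k (a :: γ) j =
      (1 - 2 * revInd a) * jumpInd ℓ k a j + netJumps ℓ k γ j := by
  unfold netJumps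
  rw [pMinus_cons]
  unfold pPlus jumpInd
  rw [List.countP_cons]
  by_cases h : Arc.Jumps ℓ k a j <;> cases a <;>
    simp [h, Arc.IsForward, revInd] <;> ring

/-- For an interval of length at most `n`, the indicator is a sum of point indicators. -/
theorem ite_inInterval_eq_sum [NeZero n] (a : ZMod n) {k : ℕ} (hk : k ≤ n) (j : ZMod n) :
    (if inInterval a k j then (1 : ℝ) else 0) =
      ∑ s ∈ Finset.range k, if j = a + (s : ZMod n) then (1 : ℝ) else 0 := by
  by_cases h : inInterval a k j
  · rw [if_pos h]
    obtain ⟨s, hs, rfl⟩ := h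
    rw [Finset.sum_eq_single_of_mem s (Finset.mem_range.2 hs), if_pos rfl]
    intro t ht hts
    refine if_neg fun heq => hts ?_
    have hcast := (ZMod.natCast_eq_natCast_iff' s t n).1 (add_left_cancel heq)
    rw [Nat.mod_eq_of_lt (hs.trans_le hk),
      Nat.mod_eq_of_lt ((Finset.mem_range.1 ht).trans_le hk)] at hcast
    exact hcast.symm
  · rw [if_neg h]
    refine (Finset.sum_eq_zero fun s hs => if_neg fun heq => h ?_).symm
    exact ⟨s, Finset.mem_range.1 hs, heq⟩

theorem sum_circMatrix [NeZero n] (ℓ : Fin m → ZMod n) {k : Fin m → ℕ} {i : Fin m}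
    (hk : k i ≤ n) : ∑ j : ZMod n, circMatrix ℓ k i j = k i := by
  simp_rw [circMatrix, ite_inInterval_eq_sum (ℓ i) hk]
  rw [Finset.sum_comm]
  simp

theorem circMatrix_succ_sub [NeZero n] (ℓ : Fin m → ZMod n) {k : Fin m → ℕ} {i : Fin m}
    (hk : k i ≤ n) (j : ZMod n) :
    circMatrix ℓ k i (j + 1) - circMatrix ℓ k i j =
      (if j = ℓ i - 1 then 1 else 0) - (if j = ℓ i + (k i : ZMod n) - 1 then 1 else 0) := by
  unfold circMatrix
  rw [ite_inInterval_eq_sum _ hk, ite_inInterval_eq_sum _ hk, ← Finset.sum_sub_distrib]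
  have htel := Finset.sum_range_sub'
    (fun s : ℕ => if j = ℓ i + (s : ZMod n) - 1 then (1 : ℝ) else 0) (k i)
  simp only [Nat.cast_zero, add_zero] at htel
  rw [← htel]
  refine Finset.sum_congr rfl fun s _ => ?_
  have h₁ : (j + 1 = ℓ i + (s : ZMod n)) ↔ (j = ℓ i + (s : ZMod n) - 1) :=
    eq_sub_iff_add_eq.symm
  have h₂ : ℓ i + ((s + 1 : ℕ) : ZMod n) - 1 = ℓ i + (s : ZMod n) := by push_cast; ring
  rw [h₂]
  simp only [h₁]

theorem sum_netJumps [NeZero n] (ℓ : Fin m → ZMod n) {k : Fin m → ℕ} (hk : ∀ i, k i ≤ n)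
    (γ : List (Arc m n)) : ∑ j : ZMod n, netJumps ℓ k γ j = (windingSum k γ : ℝ) := by
  induction γ with
  | nil => simp [netJumps, pPlus, pMinus, windingSum]
  | cons a γ ih =>
    simp_rw [netJumps_cons]
    rw [Finset.sum_add_distrib, ih]
    unfold windingSum
    rw [List.map_cons, List.sum_cons]
    push_cast
    congr 1
    rw [← Finset.mul_sum]
    cases a <;>
      simp [revInd, jumpInd_fwdRow, jumpInd_revRow, jumpInd_fwdShort, jumpInd_revShort, Arc.len,
        sum_circMatrix, hk] <;> norm_num

theorem netJumps_succ_sub [NeZero n] (ℓ : Fin m → ZMod n) {k : Fin m → ℕ} (hk : ∀ i, k i ≤ n)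
    (γ : List (Arc m n)) (j : ZMod n) :
    netJumps ℓ k γ (j + 1) - netJumps ℓ k γ j =
      (γ.map fun a => if j = Arc.tail ℓ k a then (1 : ℝ) else 0).sum -
        (γ.map fun a => if j = Arc.head ℓ k a then (1 : ℝ) else 0).sum := by
  induction γ with
  | nil => simp [netJumps, pPlus, pMinus]
  | cons a γ ih =>
    rw [netJumps_cons, netJumps_cons]
    simp only [List.map_cons, List.sum_cons]
    suffices h : (1 - 2 * revInd a) * jumpInd ℓ k a (j + 1) -
        (1 - 2 * revInd a) * jumpInd ℓ k a j =
        (if j = Arc.tail ℓ k a then 1 else 0) - (if j = Arc.head ℓ k a then 1 else 0) by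
      linarith
    cases a with
    | fwdRow i =>
      have h : circMatrix ℓ k i (j + 1) - circMatrix ℓ k i j =
          (if j = Arc.tail ℓ k (Arc.fwdRow i) then 1 else 0) -
            (if j = Arc.head ℓ k (Arc.fwdRow i) then 1 else 0) :=
        circMatrix_succ_sub ℓ (hk i) j
      simp only [revInd, jumpInd_fwdRow]
      linarith
    | revRow i =>
      have h : circMatrix ℓ k i (j + 1) - circMatrix ℓ k i j =
          (if j = Arc.head ℓ k (Arc.revRow i) then 1 else 0) -
            (if j = Arc.tail ℓ k (Arc.revRow i) then 1 else 0) :=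
        circMatrix_succ_sub ℓ (hk i) j
      simp only [revInd, jumpInd_revRow]
      linarith
    | fwdShort i =>
      have h₁ : (if i = j + 1 then (1 : ℝ) else 0) =
          if j = Arc.tail ℓ k (Arc.fwdShort i) then 1 else 0 :=
        if_congr (eq_comm.trans eq_sub_iff_add_eq.symm) rfl rfl
      have h₂ : (if i = j then (1 : ℝ) else 0) =
          if j = Arc.head ℓ k (Arc.fwdShort i) then 1 else 0 :=
        if_congr eq_comm rfl rfl
      rw [jumpInd_fwdShort, jumpInd_fwdShort, h₁, h₂, revInd]
      ring
    | revShort i =>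
      have h₁ : (if i = j + 1 then (1 : ℝ) else 0) =
          if j = Arc.head ℓ k (Arc.revShort i) then 1 else 0 :=
        if_congr (eq_comm.trans eq_sub_iff_add_eq.symm) rfl rfl
      have h₂ : (if i = j then (1 : ℝ) else 0) =
          if j = Arc.tail ℓ k (Arc.revShort i) then 1 else 0 :=
        if_congr eq_comm rfl rfl
      rw [jumpInd_revShort, jumpInd_revShort, h₁, h₂, revInd]
      ring

theorem sum_tail_add_getLast {ℓ : Fin m → ZMod n} {k : Fin m → ℕ} (f : ZMod n → ℝ)
    (γ : List (Arc m n)) (h : γ ≠ [])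
    (hc : List.IsChain (fun a b => Arc.head ℓ k a = Arc.tail ℓ k b) γ) :
    (γ.map fun a => f (Arc.tail ℓ k a)).sum + f (Arc.head ℓ k (γ.getLast h)) =
      f (Arc.tail ℓ k (γ.head h)) + (γ.map fun a => f (Arc.head ℓ k a)).sum := by
  induction γ with
  | nil => exact absurd rfl h
  | cons a γ ih =>
    cases γ with
    | nil => simp
    | cons a' γ =>
      rw [List.isChain_cons_cons] at hc
      have := ih (by simp) hc.2
      simp only [List.head_cons, ← hc.1] at this
      rw [List.getLast_cons (by simp), List.map_cons, List.sum_cons,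
        List.map_cons (f := fun a => f (Arc.head ℓ k a)), List.sum_cons, List.head_cons]
      linarith

/-- Around a closed walk, every node is jumped over a net number of `p` times. -/
theorem netJumps_eq [NeZero n] {ℓ : Fin m → ZMod n} {k : Fin m → ℕ} (hk : ∀ i, k i ≤ n)
    {γ : List (Arc m n)} (hγ : IsClosedWalk ℓ k γ) {p : ℤ}
    (hp : p * (n : ℤ) = windingSum k γ) (j : ZMod n) : netJumps ℓ k γ j = p := by
  obtain ⟨hne, hchain, hclose⟩ := hγ
  have hstep (j : ZMod n) : netJumps ℓ k γ (j + 1) = netJumps ℓ k γ j := by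
    have h := sum_tail_add_getLast (fun i => if j = i then (1 : ℝ) else 0) γ hne hchain
    rw [hclose] at h
    have h' := netJumps_succ_sub ℓ hk γ j
    linarith
  have hconst (j : ZMod n) : netJumps ℓ k γ j = netJumps ℓ k γ 0 := by
    have hnat (s : ℕ) : netJumps ℓ k γ (s : ZMod n) = netJumps ℓ k γ 0 := by
      induction s with
      | zero => simp
      | succ s ih => rw [Nat.cast_succ, hstep, ih]
    simpa using hnat j.val
  have hsum := sum_netJumps ℓ hk γ
  simp_rw [hconst] at hsum
  rw [← hp] at hsum
  simp only [Finset.sum_const, Finset.card_univ, ZMod.card, nsmul_eq_mul, Int.cast_mul,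
    Int.cast_natCast] at hsum
  rw [hconst]
  have hn : (n : ℝ) ≠ 0 := Nat.cast_ne_zero.2 (NeZero.ne n)
  exact mul_left_cancel₀ hn (by linarith)

theorem revSlack_cons [NeZero n] (ℓ : Fin m → ZMod n) (k : Fin m → ℕ) (b : Fin m → ℤ)
    (x : ZMod n → ℝ) (a : Arc m n) (γ : List (Arc m n)) :
    revSlack ℓ k b x (a :: γ) = (match a with
      | Arc.revRow i => rowSlack ℓ k b x i
      | Arc.revShort j => x j
      | _ => 0) + revSlack ℓ k b x γ := by
  unfold revSlack
  simp_rw [pMinus_cons, add_mul]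
  rw [Finset.sum_add_distrib]
  simp_rw [mul_assoc, ← Finset.mul_sum]
  cases a <;>
    simp [revInd, jumpInd_fwdRow, jumpInd_revRow, jumpInd_fwdShort, jumpInd_revShort, tMinusVal,
      rowSlack] <;> ring

theorem sum_netJumps_mul_sub_tVal_cons [NeZero n] (ℓ : Fin m → ZMod n) (k : Fin m → ℕ)
    (b : Fin m → ℤ) (x : ZMod n → ℝ) (a : Arc m n) (γ : List (Arc m n)) :
    ∑ j : ZMod n, netJumps ℓ k (a :: γ) j * x j - (tVal b (a :: γ) : ℝ) = (match a with
      | Arc.fwdRow i => rowSlack ℓ k b x i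
      | Arc.fwdShort j => x j
      | Arc.revRow i => -rowSlack ℓ k b x i
      | Arc.revShort j => -x j) +
      (∑ j : ZMod n, netJumps ℓ k γ j * x j - (tVal b γ : ℝ)) := by
  simp_rw [netJumps_cons, add_mul]
  rw [Finset.sum_add_distrib]
  simp_rw [mul_assoc, ← Finset.mul_sum]
  cases a <;>
    simp [revInd, jumpInd_fwdRow, jumpInd_revRow, jumpInd_fwdShort, jumpInd_revShort, tVal,
      rowSlack] <;> ring

theorem walkCost_eq [NeZero n] (ℓ : Fin m → ZMod n) (k : Fin m → ℕ) (b : Fin m → ℤ)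
    (x : ZMod n → ℝ) (γ : List (Arc m n)) :
    walkCost ℓ k b x γ = revSlack ℓ k b x γ +
      muVal x * (∑ j : ZMod n, netJumps ℓ k γ j * x j - (tVal b γ : ℝ)) -
        muVal x * (1 - muVal x) * netJumps ℓ k γ 0 := by
  induction γ with
  | nil => simp [walkCost, revSlack, netJumps, pPlus, pMinus, tVal, tMinusVal]
  | cons a γ ih =>
    have hcost : walkCost ℓ k b x (a :: γ) = arcCost ℓ k b x a + walkCost ℓ k b x γ := by
      simp [walkCost]
    rw [hcost, ih, revSlack_cons, sum_netJumps_mul_sub_tVal_cons, netJumps_cons]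
    cases a <;>
      simp only [arcCost, revInd, jumpInd_fwdRow, jumpInd_revRow, jumpInd_fwdShort,
        jumpInd_revShort, vRow, vShort] <;> ring

theorem rowSlack_nonneg [NeZero n] {ℓ : Fin m → ZMod n} {k : Fin m → ℕ} {b : Fin m → ℤ}
    {x : ZMod n → ℝ} (hx : x ∈ Qpoly (circMatrix ℓ k) (fun i => (b i : ℝ))) (i : Fin m) :
    0 ≤ rowSlack ℓ k b x i :=
  sub_nonneg.2 (hx.2 i)

theorem revSlack_nonneg [NeZero n] {ℓ : Fin m → ZMod n} {k : Fin m → ℕ} {b : Fin m → ℤ}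
    {x : ZMod n → ℝ} (hx : x ∈ Qpoly (circMatrix ℓ k) (fun i => (b i : ℝ)))
    (γ : List (Arc m n)) : 0 ≤ revSlack ℓ k b x γ := by
  induction γ with
  | nil => simp [revSlack, pMinus, tMinusVal]
  | cons a γ ih =>
    rw [revSlack_cons]
    cases a with
    | revRow i => exact add_nonneg (rowSlack_nonneg hx i) ih
    | revShort j => exact add_nonneg (hx.1 j) ih
    | _ => simpa using ih

/-- The total slack of the forward arcs of `γ` is nonnegative. -/
theorem fwdSlack_nonneg [NeZero n] {ℓ : Fin m → ZMod n} {k : Fin m → ℕ} {b : Fin m → ℤ}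
    {x : ZMod n → ℝ} (hx : x ∈ Qpoly (circMatrix ℓ k) (fun i => (b i : ℝ)))
    (γ : List (Arc m n)) :
    0 ≤ revSlack ℓ k b x γ + (∑ j : ZMod n, netJumps ℓ k γ j * x j - (tVal b γ : ℝ)) := by
  induction γ with
  | nil => simp [revSlack, netJumps, pPlus, pMinus, tVal, tMinusVal]
  | cons a γ ih =>
    rw [revSlack_cons, sum_netJumps_mul_sub_tVal_cons]
    cases a with
    | fwdRow i => have := rowSlack_nonneg hx i; dsimp only; linarith
    | fwdShort j => have := hx.1 j; dsimp only; linarith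
    | _ => dsimp only; linarith

/-- If `x* ∈ Q(A, b) \ Q*(A, b)` and `Γ` is a simple directed circuit of
negative cost in `D(A, x*)`, then `x*` violates the `Γ`-inequality. -/
theorem neg_cost_circuit_violates_gammaIneq {m n : ℕ} [NeZero n] (ℓ : Fin m → ZMod n)
    (k : Fin m → ℕ) (hA : circBounds n k) (b : Fin m → ℤ) (hb : ∀ i, 0 ≤ b i)
    (x : ZMod n → ℝ) (hx : x ∈ Qpoly (circMatrix ℓ k) (fun i => (b i : ℝ)))
    (hx' : x ∉ Qstar (circMatrix ℓ k) (fun i => (b i : ℝ)))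
    (γ : List (Arc m n)) (hγ : IsCircuit ℓ k γ) (hneg : walkCost ℓ k b x γ < 0)
    (p : ℤ) (hp : p * (n : ℤ) = windingSum k γ) :
    ∑ j : ZMod n, ((pMinus ℓ k γ j : ℝ) + (rVal b γ p : ℝ)) * x j <
      (rVal b γ p : ℝ) * ((betaVal b γ p : ℝ) + 1) + (tMinusVal b γ : ℝ) := by
  have hk (i : Fin m) : k i ≤ n := (hA i).2.trans (Nat.sub_le n 1)
  have hnet := netJumps_eq hk hγ.1 hp
  have hcost := walkCost_eq ℓ k b x γ
  have hrev := revSlack_nonneg hx γ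
  have hfwd := fwdSlack_nonneg hx γ
  simp_rw [hnet, ← Finset.mul_sum] at hcost hfwd
  have hgoal : ∑ j : ZMod n, ((pMinus ℓ k γ j : ℝ) + (rVal b γ p : ℝ)) * x j =
      revSlack ℓ k b x γ + (tMinusVal b γ : ℝ) + (rVal b γ p : ℝ) * ∑ j : ZMod n, x j := by
    simp_rw [add_mul]
    rw [Finset.sum_add_distrib, ← Finset.mul_sum, revSlack]
    ring
  have ht : (tVal b γ : ℝ) = betaVal b γ p * p + rVal b γ p := by
    unfold rVal
    push_cast
    ring
  rw [hgoal]
  rw [hcost] at hneg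
  have hμ : muVal x = (⌈∑ j : ZMod n, x j⌉ : ℝ) - ∑ j : ZMod n, x j := rfl
  have hμ0 : 0 ≤ muVal x := by rw [hμ]; exact sub_nonneg.2 (Int.le_ceil _)
  have hμ1 : muVal x < 1 := by
    have := Int.ceil_lt_add_one (∑ j : ZMod n, x j)
    rw [hμ]
    linarith
  have hr0 : 0 < p → 0 ≤ rVal b γ p := fun h => by
    have := Int.emod_nonneg (tVal b γ) h.ne'
    rw [rVal, betaVal, Int.fdiv_eq_ediv_of_nonneg _ h.le]
    linarith [Int.emod_add_mul_ediv (tVal b γ) p, mul_comm p (tVal b γ / p)]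
  have hrp : 0 < p → rVal b γ p < p := fun h => by
    have := Int.emod_lt_of_pos (tVal b γ) h
    rw [rVal, betaVal, Int.fdiv_eq_ediv_of_nonneg _ h.le]
    linarith [Int.emod_add_mul_ediv (tVal b γ) p, mul_comm p (tVal b γ / p)]
  generalize ∑ j : ZMod n, x j = S at *
  generalize ⌈S⌉ = N at *
  generalize muVal x = μ at *
  generalize revSlack ℓ k b x γ = R at *
  generalize rVal b γ p = r at *
  generalize betaVal b γ p = β at *
  generalize (tVal b γ : ℝ) = t at *
  obtain rfl : S = N - μ := by linarith
  have hμpos : 0 < μ := by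
    refine hμ0.lt_of_ne fun h => ?_
    rw [← h] at hneg
    linarith
  have hp0 : 0 < p := by
    by_contra! hle
    have hle' : (p : ℝ) ≤ 0 := by exact_mod_cast hle
    nlinarith [mul_nonneg hμ0 hfwd, mul_nonneg (sub_nonneg.2 hμ1.le) hrev,
      mul_nonneg (mul_nonneg hμ0 (sub_nonneg.2 hμ1.le)) (neg_nonneg.2 hle')]
  have hr0 := hr0 hp0
  have hrp := hrp hp0
  have hR : R < μ * (t - p * (N - 1)) := by linarith
  have hlower : (p : ℝ) * (N - 1) < t := by
    have := (pos_iff_pos_of_mul_pos (hrev.trans_lt hR)).1 hμpos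
    linarith
  have hupper : t < p * N := by
    have h : 0 < (1 - μ) * (p * N - t) := by linarith
    have := (pos_iff_pos_of_mul_pos h).1 (sub_pos.2 hμ1)
    linarith
  rw [ht] at hlower hupper
  have hlower' : p * (N - 1) < β * p + r := by exact_mod_cast hlower
  have hupper' : β * p + r < p * N := by exact_mod_cast hupper
  have hβ : β = N - 1 := by
    have h₁ : N - 1 < β + 1 := lt_of_mul_lt_mul_left (by linarith) hp0.le
    have h₂ : β < N := lt_of_mul_lt_mul_left (by linarith) hp0.le
    omega
  subst hβ
  push_cast at ht ⊢
  rw [ht] at hR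
  linarith

end CircCover
end
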